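/- For every 0 ≤ l ≤ g − 1 and every integer n ≥ 0: if δ^n lies in the closure of W_l, then δ^{n+1} lies in the closure of W_{l+1}. -/

import Mathlib

/-- The map `r_b` on `ℂ ∪ {∞}` (modelled as `Option ℂ`, with `none = ∞`). -/
noncomputable def rr (b : ℂ) : Option ℂ → ℂ :=
  fun z => z.elim 1 (fun w => (w - b) / (w - b⁻¹))

/-- A point of `ℂ ∪ {∞}` avoids all the `b_i^{±1}`. -/
def Allowed {g : ℕ} (b : Fin g → ℂ) (w : Option ℂ) : Prop :=
  ∀ i, w ≠ some (b i) ∧ w ≠ some (b i)⁻¹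

/-- `W_l` for a natural number `l`. -/
def Wn {g : ℕ} (b : Fin g → ℂ) (l : ℕ) : Set (Fin g → ℂ) :=
  {x | ∃ z : Fin l → Option ℂ, (∀ j, Allowed b (z j)) ∧ ∀ i, x i = ∏ j, rr (b i) (z j)}

/-- `W_l` for an integer `l` (empty for negative `l`). -/
def W {g : ℕ} (b : Fin g → ℂ) (l : ℤ) : Set (Fin g → ℂ) :=
  {x | ∃ m : ℕ, (m : ℤ) = l ∧ x ∈ Wn b m}

/-- The torus `(ℂ^×)^g` inside `ℂ^g`. -/
def Torus (g : ℕ) : Set (Fin g → ℂ) := {x | ∀ i, x i ≠ 0}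

/-- Closure taken inside the torus `(ℂ^×)^g` (Euclidean topology). -/
noncomputable def closT {g : ℕ} (S : Set (Fin g → ℂ)) : Set (Fin g → ℂ) :=
  closure S ∩ Torus g

theorem rr_zero {b : ℂ} (hb : b ≠ 0) : rr b (some 0) = b ^ 2 := by
  simp only [rr, Option.elim_some]
  field_simp
  ring

theorem allowed_zero {g : ℕ} {b : Fin g → ℂ} (hb : ∀ i, b i ≠ 0) : Allowed b (some 0) :=
  fun i => ⟨by simpa using (hb i).symm, by simpa using (hb i).symm⟩

/-- Multiplication by `r(w)` maps `W_l` into `W_{l+1}`. -/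
theorem mul_rr_mem_Wn {g : ℕ} {b : Fin g → ℂ} {l : ℕ} {x : Fin g → ℂ} {w : Option ℂ}
    (hw : Allowed b w) (hx : x ∈ Wn b l) : (fun i => x i * rr (b i) w) ∈ Wn b (l + 1) := by
  obtain ⟨z, hz, hxz⟩ := hx
  refine ⟨Fin.snoc z w, Fin.lastCases (by simpa using hw) (by simpa using hz), fun i => ?_⟩
  simp [Fin.prod_univ_castSucc, hxz]

/-- If `δ^n` lies in the closure of `W_l` (with `l ≤ g − 1`), then `δ^{n+1}` lies in the
closure of `W_{l+1}`. -/
theorem stmt19 (g : ℕ) (hg : 1 ≤ g) (ρ β b : Fin g → ℂ)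
    (hρdist : Function.Injective ρ) (hρ1 : ∀ i, ρ i ≠ 1 ∧ ρ i ≠ -1)
    (hβ : ∀ i, β i ^ 2 = ρ i ^ 2 - 1) (hbdef : ∀ i, b i = ρ i + β i)
    (hbinj : Function.Injective b) (hbInv : ∀ i j, b i ≠ (b j)⁻¹)
    (l : ℕ) (hl : l + 1 ≤ g) (n : ℕ)
    (h : (fun i => b i ^ (2 * n)) ∈ closT (Wn b l)) :
    (fun i => b i ^ (2 * (n + 1))) ∈ closT (Wn b (l + 1)) := by
  have hb : ∀ i, b i ≠ 0 := fun i h0 => by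
    have hρβ : β i = -ρ i := by linear_combination h0 - hbdef i
    have := hβ i
    rw [hρβ] at this
    exact one_ne_zero (α := ℂ) (by linear_combination this)
  refine ⟨?_, fun i => pow_ne_zero _ (hb i)⟩
  have hcont : Continuous fun x : Fin g → ℂ => fun i => x i * rr (b i) (some 0) := by fun_prop
  have := map_mem_closure hcont h.1 fun _ hx => mul_rr_mem_Wn (allowed_zero hb) hx
  simpa only [rr_zero (hb _), ← pow_add, ← mul_add_one] using this
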